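/- arXiv:1506.08655 — 6 statements merged into one kernel-verified Lean document; each statement's English description precedes it below -/
import Mathlib

section
/- For every integer n ≥ 4, n does not divide (n-3)! if and only if n is prime or n = 4. -/
theorem aux_mul_dvd (a b : ℕ) (ha : 0 < a) (h : a < b) : a * b ∣ Nat.factorial b := by
  obtain ⟨c, rfl⟩ : ∃ c, b = c + 1 := ⟨b - 1, by omega⟩
  rw [Nat.factorial_succ, mul_comm a]
  exact Nat.mul_dvd_mul_left _ (Nat.dvd_factorial ha (by omega))

theorem stmt_1 (n : ℕ) (hn : 4 ≤ n) :
    ¬ (n ∣ Nat.factorial (n - 3)) ↔ (Nat.Prime n ∨ n = 4) := by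
  constructor
  · intro h
    by_contra hc
    push Not at hc
    obtain ⟨hp, h4⟩ := hc
    apply h
    obtain ⟨m, hm⟩ := Nat.minFac_dvd n
    have h2 : 2 ≤ n.minFac := (Nat.minFac_prime (by omega)).two_le
    have hsq := Nat.minFac_sq_le_self (by omega : 0 < n) hp
    generalize n.minFac = p at *
    have hle : p ≤ m := by
      by_contra hlt
      push Not at hlt
      nlinarith
    rcases hle.lt_or_eq with hlt | heq
    · have h1 := aux_mul_dvd p m (by omega) hlt
      rw [← hm] at h1
      have : 2 * m ≤ n := by nlinarith
      exact h1.trans (Nat.factorial_dvd_factorial (by omega))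
    · subst heq
      have h3 : 3 ≤ p := by
        by_contra h'
        have : p = 2 := by omega
        subst this
        omega
      have h1 := aux_mul_dvd p (2 * p) (by omega) (by omega)
      have hd : n ∣ p * (2 * p) := ⟨2, by rw [hm]; ring⟩
      have : 2 * p + 3 ≤ n := by nlinarith
      exact (hd.trans h1).trans (Nat.factorial_dvd_factorial (by omega))
  · rintro (hp | rfl)
    · rw [hp.dvd_factorial]
      omega
    · decide
end

section
/- If n > 4 is a composite integer and n is a perfect square, then n divides (n-3)!. -/
theorem stmt_2 (n : ℕ) (hn : 4 < n) (hcomp : ¬ Nat.Prime n)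
    (hsq : ∃ m : ℕ, n = m ^ 2) :
    n ∣ Nat.factorial (n - 3) := by
  obtain ⟨m, rfl⟩ := hsq
  have hm : 3 ≤ m := by
    by_contra h
    have : m ≤ 2 := by omega
    nlinarith
  have h1 : 2 * m ≤ m ^ 2 - 3 := by
    apply Nat.le_sub_of_add_le
    nlinarith
  refine Dvd.dvd.trans ?_ (Nat.factorial_dvd_factorial h1)
  rw [← Nat.mul_factorial_pred (by omega : 2 * m ≠ 0), pow_two]
  exact mul_dvd_mul (Dvd.intro_left 2 rfl) (Nat.dvd_factorial (by omega) (by omega))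
end

section
/- For every positive integer x, there exist positive integers x_1, x_2, x_3, x_4, x_5 satisfying the system x_1 + 1 = x, x! = x_2, x_2 + 1 = x_3, x_1! = x_4, x_2! = x_5, x does not divide x_4, and x_3 does not divide x_5, if and only if both x and x! + 1 are prime. -/
theorem aux_lt (p q m : ℕ) (hp : 0 < p) (hpq : p < q) (hq : q ≤ m) : p * q ∣ Nat.factorial m := by
  refine dvd_trans ?_ (Nat.factorial_dvd_factorial hq)
  obtain ⟨k, rfl⟩ : ∃ k, q = k + 1 := ⟨q - 1, by omega⟩
  rw [Nat.factorial_succ, mul_comm]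
  exact Nat.mul_dvd_mul_left _ (Nat.dvd_factorial hp (by omega))

theorem aux_comp (m : ℕ) (hm : 0 < m) (h4 : m + 1 ≠ 4) (h : ¬ (m + 1 ∣ Nat.factorial m)) :
    Nat.Prime (m + 1) := by
  by_contra hnp
  apply h
  obtain ⟨a, ha, ha2, ham⟩ := Nat.exists_dvd_of_not_prime2 (by omega) hnp
  obtain ⟨b, hb⟩ := ha
  have hb2 : 2 ≤ b := by
    by_contra hlt
    have : b = 0 ∨ b = 1 := by omega
    rcases this with rfl | rfl <;> omega
  have hbm : b < m + 1 := by nlinarith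
  rcases lt_trichotomy a b with hab | hab | hab
  · rw [hb]; exact aux_lt a b m (by omega) hab (by omega)
  · subst hab
    have h3 : 3 ≤ a := by
      by_contra hlt
      have : a = 2 := by omega
      subst this; omega
    rw [hb]
    exact dvd_trans ⟨2, by ring⟩ (aux_lt a (2 * a) m (by omega) (by omega) (by nlinarith))
  · rw [hb, mul_comm]; exact aux_lt b a m (by omega) hab (by omega)

theorem aux_prime (m : ℕ) (h : Nat.Prime (m + 1)) : ¬ (m + 1 ∣ Nat.factorial m) := by
  rw [h.dvd_factorial]; omega

theorem stmt_8 (x : ℕ) (hx : 0 < x) :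
    (∃ x1 x2 x3 x4 x5 : ℕ, 0 < x1 ∧ 0 < x2 ∧ 0 < x3 ∧ 0 < x4 ∧ 0 < x5 ∧
      x1 + 1 = x ∧ Nat.factorial x = x2 ∧ x2 + 1 = x3 ∧
      Nat.factorial x1 = x4 ∧ Nat.factorial x2 = x5 ∧
      ¬ (x ∣ x4) ∧ ¬ (x3 ∣ x5))
    ↔ (Nat.Prime x ∧ Nat.Prime (Nat.factorial x + 1)) := by
  constructor
  · rintro ⟨x1, x2, x3, x4, x5, h1, h2, -, -, -, rfl, rfl, rfl, rfl, rfl, ha, hb⟩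
    have hP : Nat.Prime (Nat.factorial (x1 + 1) + 1) := by
      refine aux_comp _ h2 ?_ hb
      intro h
      have h3 : Nat.factorial (x1 + 1) = 3 := by omega
      have : 2 ∣ Nat.factorial (x1 + 1) := Nat.dvd_factorial (by omega) (by omega)
      omega
    refine ⟨aux_comp _ h1 ?_ ha, hP⟩
    intro h
    rw [h] at hP
    revert hP
    norm_num [Nat.factorial]
  · rintro ⟨hp, hq⟩
    obtain ⟨k, rfl⟩ : ∃ k, x = k + 1 := ⟨x - 1, by omega⟩
    have := hp.two_le
    exact ⟨k, _, _, _, _, by omega, Nat.factorial_pos _, Nat.succ_pos _, Nat.factorial_pos _,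
      Nat.factorial_pos _, rfl, rfl, rfl, rfl, rfl, aux_prime _ hp, aux_prime _ hq⟩
end

section
/- For all positive integers x and y, there exist positive integers x_1, x_2, x_3 satisfying the system x_1 + 1 = x, x + 1 = x_2, x_2 + 1 = y, x_1! = x_3, x does not divide x_3, y does not divide x_3, and x does not divide y, if and only if x and y are both prime and x + 2 = y. -/
theorem aux_dvd (p q m : ℕ) (hp : 0 < p) (hpq : p ≤ q) (hq : q ≤ m)
    (h : p < q ∨ 2 * p ≤ m) : p * q ∣ Nat.factorial m := by
  rcases Nat.lt_or_ge p q with h1 | h1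
  · obtain ⟨k, rfl⟩ : ∃ k, q = k + 1 := ⟨q - 1, by omega⟩
    refine dvd_trans ?_ (Nat.factorial_dvd_factorial hq)
    rw [Nat.factorial_succ, mul_comm]
    exact mul_dvd_mul_left _ (Nat.dvd_factorial hp (by omega))
  · obtain rfl : p = q := by omega
    have h2 : p + p ≤ m := by omega
    refine dvd_trans ?_ (Nat.factorial_dvd_factorial h2)
    exact dvd_trans (mul_dvd_mul (Nat.dvd_factorial hp le_rfl) (Nat.dvd_factorial hp le_rfl))
      (Nat.factorial_mul_factorial_dvd_factorial_add p p)

theorem aux_split (n : ℕ) (h2 : 2 ≤ n) (hn : ¬ n.Prime) :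
    ∃ p q, 2 ≤ p ∧ p ≤ q ∧ n = p * q := by
  obtain ⟨q, hq⟩ := Nat.minFac_dvd n
  have h1 := (Nat.minFac_prime (n := n) (by omega)).two_le
  have h3 := Nat.minFac_sq_le_self (by omega) hn
  refine ⟨n.minFac, q, h1, ?_, hq⟩
  generalize n.minFac = p at *
  subst hq
  nlinarith

theorem stmt_10 (x y : ℕ) (hx : 0 < x) (hy : 0 < y) :
    (∃ x1 x2 x3 : ℕ, 0 < x1 ∧ 0 < x2 ∧ 0 < x3 ∧
      x1 + 1 = x ∧ x + 1 = x2 ∧ x2 + 1 = y ∧ Nat.factorial x1 = x3 ∧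
      ¬ (x ∣ x3) ∧ ¬ (y ∣ x3) ∧ ¬ (x ∣ y))
    ↔ (Nat.Prime x ∧ Nat.Prime y ∧ x + 2 = y) := by
  constructor
  · rintro ⟨m, _, _, hm, -, -, rfl, rfl, rfl, rfl, h1, h2, h3⟩
    have hxp : Nat.Prime (m + 1) := by
      by_contra hn
      obtain ⟨p, q, hp, hpq, he⟩ := aux_split _ (by omega) hn
      by_cases h4 : m = 3
      · subst h4
        exact h2 (by decide)
      · apply h1
        rw [he]
        apply aux_dvd p q m (by omega) hpq (by nlinarith)
        by_contra! hc
        obtain rfl : p = q := by omega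
        rcases (by omega : p = 2 ∨ 3 ≤ p) with rfl | h5
        · omega
        · nlinarith
    have hodd : ¬ 2 ∣ m + 1 := by
      intro h
      have := (Nat.prime_dvd_prime_iff_eq Nat.prime_two hxp).1 h
      obtain rfl : m = 1 := by omega
      exact h3 (by decide)
    refine ⟨hxp, ?_, by omega⟩
    by_contra hn
    obtain ⟨p, q, hp, hpq, he⟩ := aux_split _ (by omega) hn
    have hp3 : 3 ≤ p := by
      rcases (by omega : p = 2 ∨ 3 ≤ p) with rfl | h5
      · omega
      · exact h5
    apply h2
    rw [he]
    apply aux_dvd p q m (by omega) hpq (by nlinarith)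
    by_contra! hc
    obtain rfl : p = q := by omega
    nlinarith
  · rintro ⟨hxp, hyp, rfl⟩
    have := hxp.two_le
    refine ⟨x - 1, x + 1, _, by omega, by omega, Nat.factorial_pos _, by omega, rfl, rfl, rfl, ?_, ?_, ?_⟩
    · rw [hxp.dvd_factorial]; omega
    · rw [hyp.dvd_factorial]; omega
    · intro h
      have h' : x ∣ 2 := (Nat.dvd_add_right (dvd_refl x)).1 h
      have := Nat.le_of_dvd (by norm_num) h'
      obtain rfl : x = 2 := by omega
      revert hyp; decide
end

section
/- The statement Φ_5 implies that there are infinitely many positive integers x such that x! - 1 is prime. -/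
/-- f(1) = 2, f(2) = 3, and f(n+1) = f(n)! for every n ≥ 2. -/
def f : ℕ → ℕ
  | 0 => 1
  | 1 => 2
  | 2 => 3
  | n + 3 => Nat.factorial (f (n + 2))

/-- The set of solutions in positive integers of a system
`S ⊆ {x_i + 1 = x_k, x_i! = x_k, x_i ∤ x_k : i, k ∈ {1,...,n}}`,
described by the three relations `A`, `F`, `D` on indices. -/
def SolutionSet (n : ℕ) (A F D : Fin n → Fin n → Prop) : Set (Fin n → ℕ) :=
  {x | (∀ j, 0 < x j) ∧
       (∀ i k, A i k → x i + 1 = x k) ∧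
       (∀ i k, F i k → Nat.factorial (x i) = x k) ∧
       (∀ i k, D i k → ¬ (x i ∣ x k))}

/-- The statement Φ_n: if a system has only finitely many solutions in positive
integers x_1, ..., x_n, then each such solution satisfies x_1, ..., x_n ≤ f(n). -/
def Phi (n : ℕ) : Prop :=
  ∀ A F D : Fin n → Fin n → Prop,
    (SolutionSet n A F D).Finite →
      ∀ x ∈ SolutionSet n A F D, ∀ j, x j ≤ f n

theorem aux_dvd_s13 (a b p : ℕ) (ha : 0 < a) (hab : a < b) (hb : b < p) :
    a * b ∣ Nat.factorial (p - 1) := by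
  have h1 : a ∣ Nat.factorial (b - 1) := Nat.dvd_factorial ha (by omega)
  have h2 : b * Nat.factorial (b - 1) = Nat.factorial b := Nat.mul_factorial_pred (by omega)
  have h3 : Nat.factorial b ∣ Nat.factorial (p - 1) := Nat.factorial_dvd_factorial (by omega)
  rw [← h2] at h3
  rw [mul_comm a b]
  exact (Nat.mul_dvd_mul_left b h1).trans h3

theorem aux_prime_s13 (p : ℕ) (hp : 2 ≤ p) (h4 : p ≠ 4)
    (h : ¬ p ∣ Nat.factorial (p - 1)) : Nat.Prime p := by
  by_contra hn
  obtain ⟨a, b, ha, hb, hab⟩ := (Nat.not_prime_iff_exists_mul_eq hp).1 hn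
  apply h
  have ha0 : 0 < a := by
    rcases Nat.eq_zero_or_pos a with h0 | h0
    · subst h0; omega
    · exact h0
  have hb0 : 0 < b := by
    rcases Nat.eq_zero_or_pos b with h0 | h0
    · subst h0; omega
    · exact h0
  rcases lt_trichotomy a b with hl | hl | hl
  · have := aux_dvd_s13 a b p ha0 hl hb
    rwa [hab] at this
  · subst hl
    have ha3 : 3 ≤ a := by
      by_contra hc
      have : a = 1 ∨ a = 2 := by omega
      rcases this with h | h <;> subst h <;> omega
    have := aux_dvd_s13 a (2 * a) p ha0 (by omega) (by nlinarith)
    refine Dvd.dvd.trans ?_ this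
    exact ⟨2, by rw [← hab]; ring⟩
  · have := aux_dvd_s13 b a p hb0 hl ha
    rwa [mul_comm, hab] at this

theorem aux_fac (x : ℕ) : Nat.factorial x ≠ 5 := by
  intro h
  rcases Nat.lt_or_ge x 3 with h3 | h3
  · interval_cases x <;> simp [Nat.factorial] at h
  · have h6 := Nat.factorial_le h3
    have : Nat.factorial 3 = 6 := rfl
    omega

theorem aux_f5 : f 5 = Nat.factorial 720 := by
  have h4 : f 4 = 720 := by simp [f, Nat.factorial]
  have : f 5 = Nat.factorial (f 4) := by rw [f]
  rw [this, h4]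

theorem stmt_13 (hPhi : Phi 5) (h7 : Nat.Prime (Nat.factorial 7 - 1)) :
    {x : ℕ | 0 < x ∧ Nat.Prime (Nat.factorial x - 1)}.Infinite := by
  intro hfin
  have e7 : Nat.factorial 7 = 5040 := by simp [Nat.factorial]
  let A : Fin 5 → Fin 5 → Prop := fun i k => (i = 2 ∧ k = 1) ∨ (i = 3 ∧ k = 2)
  let F : Fin 5 → Fin 5 → Prop := fun i k => (i = 0 ∧ k = 1) ∨ (i = 3 ∧ k = 4)
  let D : Fin 5 → Fin 5 → Prop := fun i k => i = 2 ∧ k = 4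
  let g : ℕ → Fin 5 → ℕ := fun x => ![x, Nat.factorial x, Nat.factorial x - 1,
    Nat.factorial x - 2, Nat.factorial (Nat.factorial x - 2)]
  have hS : (SolutionSet 5 A F D).Finite := by
    refine (hfin.image g).subset ?_
    rintro x ⟨hpos, hA, hF, hD⟩
    have a1 := hA 2 1 (Or.inl ⟨rfl, rfl⟩)
    have a2 := hA 3 2 (Or.inr ⟨rfl, rfl⟩)
    have f1 := hF 0 1 (Or.inl ⟨rfl, rfl⟩)
    have f2 := hF 3 4 (Or.inr ⟨rfl, rfl⟩)
    have d := hD 2 4 ⟨rfl, rfl⟩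
    have p3 := hpos 3
    have n5 := aux_fac (x 0)
    have e2 : x 2 = Nat.factorial (x 0) - 1 := by omega
    have e3 : x 3 = Nat.factorial (x 0) - 2 := by omega
    refine ⟨x 0, ⟨hpos 0, ?_⟩, ?_⟩
    · rw [← e2]
      apply aux_prime_s13 _ (by omega) (by omega)
      have : x 2 - 1 = x 3 := by omega
      rw [this, f2]
      exact d
    · funext j
      fin_cases j
      · rfl
      · exact f1
      · exact e2.symm
      · exact e3.symm
      · change Nat.factorial (Nat.factorial (x 0) - 2) = x 4
        rw [← e3, f2]
  have hm : g 7 ∈ SolutionSet 5 A F D := by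
    refine ⟨?_, ?_, ?_, ?_⟩
    · intro j
      fin_cases j
      · change 0 < 7
        norm_num
      · exact Nat.factorial_pos 7
      · change 0 < Nat.factorial 7 - 1
        omega
      · change 0 < Nat.factorial 7 - 2
        omega
      · exact Nat.factorial_pos _
    · rintro i k (⟨rfl, rfl⟩ | ⟨rfl, rfl⟩)
      · change Nat.factorial 7 - 1 + 1 = Nat.factorial 7
        omega
      · change Nat.factorial 7 - 2 + 1 = Nat.factorial 7 - 1
        omega
    · rintro i k (⟨rfl, rfl⟩ | ⟨rfl, rfl⟩)
      · rfl
      · rfl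
    · rintro i k ⟨rfl, rfl⟩
      change ¬ (Nat.factorial 7 - 1 ∣ Nat.factorial (Nat.factorial 7 - 2))
      rw [h7.dvd_factorial]
      omega
  have hle := hPhi A F D hS (g 7) hm 4
  have hle' : Nat.factorial (Nat.factorial 7 - 2) ≤ f 5 := hle
  rw [aux_f5] at hle'
  have hlt : Nat.factorial 720 < Nat.factorial (Nat.factorial 7 - 2) :=
    (Nat.factorial_lt (by norm_num)).2 (by omega)
  exact absurd hle' (Nat.not_le.2 hlt)
end

section
/- For every integer n ≥ 3, the system consisting of x_1! = x_1, x_1 + 1 = x_2, and x_i! = x_{i+1} for every i ∈ {2,...,n-1}, has exactly two solutions in positive integers, namely (1, 2, 2, ..., 2) and (f(1), f(2), ..., f(n)). -/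
/-- Here the variables x_1, ..., x_n of the paper are represented by
`x 0, ..., x (n-1)`, so the system x_1! = x_1, x_1 + 1 = x_2, and
x_i! = x_{i+1} for i ∈ {2,...,n-1} becomes `(x 0)! = x 0`, `x 0 + 1 = x 1`,
and `(x j)! = x (j+1)` for j ∈ {1,...,n-2}; the two solutions (1,2,...,2)
and (f(1),...,f(n)) become `x j = if j = 0 then 1 else 2` and `x j = f (j+1)`. -/
theorem stmt_18 (n : ℕ) (hn : 3 ≤ n) (x : Fin n → ℕ) :
    ((∀ j, 0 < x j) ∧
      Nat.factorial (x ⟨0, by omega⟩) = x ⟨0, by omega⟩ ∧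
      x ⟨0, by omega⟩ + 1 = x ⟨1, by omega⟩ ∧
      (∀ j : Fin n, ∀ _h1 : 1 ≤ (j : ℕ), ∀ _h2 : (j : ℕ) ≤ n - 2,
        Nat.factorial (x j) = x ⟨(j : ℕ) + 1, by omega⟩))
    ↔ ((∀ j : Fin n, x j = if (j : ℕ) = 0 then 1 else 2) ∨
       (∀ j : Fin n, x j = f ((j : ℕ) + 1))) := by
  have fpos : ∀ m, 0 < f m := by
    intro m
    match m with
    | 0 => simp [f]
    | 1 => simp [f]
    | 2 => simp [f]
    | k + 3 => rw [f]; exact Nat.factorial_pos _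
  constructor
  · rintro ⟨hpos, h0, h1, hs⟩
    have hle : x ⟨0, by omega⟩ ≤ 2 := by
      by_contra hc
      have := Nat.lt_factorial_self (n := x ⟨0, by omega⟩) (by omega)
      omega
    have hp := hpos ⟨0, by omega⟩
    have hcase : x ⟨0, by omega⟩ = 1 ∨ x ⟨0, by omega⟩ = 2 := by omega
    rcases hcase with hc | hc
    · left
      have key : ∀ k, ∀ hk : k + 1 < n, x ⟨k + 1, hk⟩ = 2 := by
        intro k
        induction k with
        | zero => intro hk; rw [← h1, hc]
        | succ k ih =>
          intro hk
          have h := hs ⟨k + 1, by omega⟩ (by simp) (by simp only; omega)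
          rw [ih (by omega)] at h
          exact h.symm
      rintro ⟨j, hj⟩
      cases j with
      | zero => simpa using hc
      | succ k => simpa using key k hj
    · right
      have key : ∀ k, ∀ hk : k + 1 < n, x ⟨k + 1, hk⟩ = f (k + 2) := by
        intro k
        induction k with
        | zero => intro hk; rw [← h1, hc]; simp [f]
        | succ k ih =>
          intro hk
          have h := hs ⟨k + 1, by omega⟩ (by simp) (by simp only; omega)
          rw [ih (by omega)] at h
          rw [f]
          exact h.symm
      rintro ⟨j, hj⟩
      cases j with
      | zero => rw [hc]; simp [f]
      | succ k => exact key k hj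
  · rintro (h | h)
    · refine ⟨?_, ?_, ?_, ?_⟩
      · intro j; rw [h]; split_ifs <;> norm_num
      · rw [h]; simp
      · rw [h, h]; simp
      · intro j h1 h2
        have hj : (j : ℕ) ≠ 0 := by omega
        rw [h, h]; simp [hj]
    · refine ⟨?_, ?_, ?_, ?_⟩
      · intro j; rw [h]; exact fpos _
      · rw [h]; simp [f]
      · rw [h, h]; simp [f]
      · intro j h1 h2
        rw [h, h]
        obtain ⟨j, hj⟩ := j
        cases j with
        | zero => simp at h1
        | succ k => simp only; rw [f]
end
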